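/- arXiv:1612.08637 — 2 statements merged into one kernel-verified Lean document; each statement's English description precedes it below -/
import Mathlib

section
/- Let Λ = ℤⁿ and U = [-1,1]ⁿ. Then for every r ∈ ℕ, C_n([-1,1]ⁿ, [-r,r]ⁿ) ≥ (2r-1)ⁿ · 2ⁿ / (2r)ⁿ = (2 - 1/r)ⁿ. -/
open MeasureTheory Complex Pointwise

noncomputable section

/-- A continuous-type positive definiteness condition for complex-valued
functions on `ℝⁿ`: all finite quadratic forms are real and nonnegative. -/
def IsPosDefC {n : ℕ} (f : (Fin n → ℝ) → ℂ) : Prop :=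
  ∀ (X : Finset (Fin n → ℝ)) (c : (Fin n → ℝ) → ℂ),
    0 ≤ (∑ a ∈ X, ∑ b ∈ X, c a * (starRingEnd ℂ) (c b) * f (a - b)).re ∧
    (∑ a ∈ X, ∑ b ∈ X, c a * (starRingEnd ℂ) (c b) * f (a - b)).im = 0

/-- Positive definiteness for real-valued functions on `ℝⁿ`. -/
def IsPosDefR {n : ℕ} (f : (Fin n → ℝ) → ℝ) : Prop :=
  IsPosDefC (fun x => (f x : ℂ))

/-- The set of ratios `(|V|⁻¹ ∫_V f) / (|U|⁻¹ ∫_U f)` over nonzero continuous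
non-negative positive definite `f`. -/
def ratioSet (n : ℕ) (U V : Set (Fin n → ℝ)) : Set ℝ :=
  { c | ∃ f : (Fin n → ℝ) → ℝ, Continuous f ∧ (∀ x, 0 ≤ f x) ∧ IsPosDefR f ∧
      f ≠ 0 ∧ 0 < ∫ x in U, f x ∧
      c = ((volume V).toReal⁻¹ * ∫ x in V, f x) /
          ((volume U).toReal⁻¹ * ∫ x in U, f x) }

/-- The sharp constant `C_n(U,V)` in the doubling-type condition at the origin. -/
def doublingConst (n : ℕ) (U V : Set (Fin n → ℝ)) : ℝ := sSup (ratioSet n U V)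

/-- A `0`-symmetric convex body in `ℝⁿ`. -/
def IsSymConvexBody {n : ℕ} (U : Set (Fin n → ℝ)) : Prop :=
  Convex ℝ U ∧ IsCompact U ∧ (interior U).Nonempty ∧ U = -U


lemma posDef_even {n : ℕ} {f : (Fin n → ℝ) → ℝ} (hf : IsPosDefR f) (x : Fin n → ℝ) :
    f (-x) = f x := by
  classical
  by_cases hx : x = 0
  · simp [hx]
  have h := (hf {x, 0} (fun a => if a = 0 then Complex.I else 1)).2
  rw [Finset.sum_pair hx, Finset.sum_pair hx, Finset.sum_pair hx] at h
  simp [hx] at h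
  linarith

lemma posDef_real {n : ℕ} {f : (Fin n → ℝ) → ℝ} (hf : IsPosDefR f)
    (X : Finset (Fin n → ℝ)) (c : (Fin n → ℝ) → ℝ) :
    0 ≤ ∑ a ∈ X, ∑ b ∈ X, c a * c b * f (a - b) := by
  have h := (hf X (fun a => (c a : ℂ))).1
  simpa [← Complex.ofReal_mul, ← Complex.ofReal_sum] using h

lemma exists_feature {n : ℕ} {f : (Fin n → ℝ) → ℝ} (hc : Continuous f) (hf : IsPosDefR f) :
    ∃ (H : Type) (_ : NormedAddCommGroup H) (_ : InnerProductSpace ℝ H) (_ : CompleteSpace H)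
      (φ : (Fin n → ℝ) → H), Continuous φ ∧ ∀ a b, inner ℝ (φ a) (φ b) = f (a - b) := by
  let K : Matrix (Fin n → ℝ) (Fin n → ℝ) (ℝ →L[ℝ] ℝ) :=
    .of fun x y => f (x - y) • ContinuousLinearMap.id ℝ ℝ
  have hK : K.PosSemidef := by
    have e := (RKHS.posSemidef_tfae (K := K)).out 2 0
    refine e.mp ⟨?_, ?_⟩
    · ext x y
      simp only [K, Matrix.conjTranspose_apply, Matrix.of_apply, star_smul]
      rw [← posDef_even hf (x - y), neg_sub]
      have hid : ContinuousLinearMap.adjoint (ContinuousLinearMap.id ℝ ℝ) =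
          ContinuousLinearMap.id ℝ ℝ := ContinuousLinearMap.adjoint_id
      simp [ContinuousLinearMap.star_eq_adjoint, hid]
    · intro v
      have := posDef_real hf v.support v
      simp only [Finsupp.sum]
      refine this.trans_eq ?_
      simp only [K]
      simp
      refine Finset.sum_congr rfl fun a _ => Finset.sum_congr rfl fun b _ => ?_
      rw [← posDef_even hf (b - a), neg_sub]
      ring
  have : Fact K.PosSemidef := ⟨hK⟩
  let φ : (Fin n → ℝ) → RKHS.OfKernel K := fun x => RKHS.kerFun (RKHS.OfKernel K) x (1 : ℝ)
  have hφ : ∀ a b, inner ℝ (φ a) (φ b) = f (a - b) := by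
    intro a b
    have h := RKHS.kernel_inner (RKHS.OfKernel K) b a (1 : ℝ) (1 : ℝ)
    rw [RKHS.OfKernel.kernel_ofKernel] at h
    simp only [φ]
    rw [← posDef_even hf, neg_sub]
    rw [← h]; simp [K]
  refine ⟨RKHS.OfKernel K, inferInstance, inferInstance, inferInstance, φ, ?_, hφ⟩
  rw [continuous_iff_continuousAt]
  intro a
  rw [ContinuousAt, tendsto_iff_norm_sub_tendsto_zero]
  have h1 : ∀ x, ‖φ x - φ a‖ = Real.sqrt (2 * f 0 - 2 * f (x - a)) := by
    intro x
    rw [eq_comm, Real.sqrt_eq_iff_eq_sq, @norm_sub_sq_real, hφ, ← real_inner_self_eq_norm_sq,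
      ← real_inner_self_eq_norm_sq, hφ, hφ]
    · simp; ring
    · have := sq_nonneg (‖φ x - φ a‖)
      rw [@norm_sub_sq_real, hφ, ← real_inner_self_eq_norm_sq,
        ← real_inner_self_eq_norm_sq, hφ, hφ] at this
      simp at this; linarith
    · positivity
  simp_rw [h1]
  have h2 : Continuous fun x => Real.sqrt (2 * f 0 - 2 * f (x - a)) := by fun_prop
  have := h2.tendsto a
  simpa using this

lemma setInt_shift {n : ℕ} (f : (Fin n → ℝ) → ℝ) (w : Fin n → ℝ) (ρ : ℝ) :
    ∫ x in Metric.closedBall 0 ρ, f (x + w) = ∫ x in Metric.closedBall w ρ, f x := by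
  have h := (measurePreserving_add_right (volume : Measure (Fin n → ℝ)) w).setIntegral_preimage_emb
    (MeasurableEquiv.addRight w).measurableEmbedding f (Metric.closedBall w ρ)
  rw [← h]
  congr 2
  ext x
  simp [dist_eq_norm]

lemma intOn_closedBall {n : ℕ} {f : (Fin n → ℝ) → ℝ} (hc : Continuous f) (w : Fin n → ℝ) (ρ : ℝ) :
    IntegrableOn f (Metric.closedBall w ρ) :=
  hc.continuousOn.integrableOn_compact (isCompact_closedBall _ _)

lemma key_bound {n : ℕ} {f : (Fin n → ℝ) → ℝ} (hc : Continuous f) (h0 : ∀ x, 0 ≤ f x)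
    (hf : IsPosDefR f) (t : Fin n → ℝ) :
    volume.real (Metric.closedBall (0 : Fin n → ℝ) (1/4)) *
        ∫ x in Metric.closedBall t (1/4), f x ≤
      volume.real (Metric.closedBall (0 : Fin n → ℝ) (1/2)) *
        ∫ x in Metric.closedBall 0 1, f x := by
  obtain ⟨H, _, _, _, φ, hφc, hφ⟩ := exists_feature hc hf
  set Q := Metric.closedBall (0 : Fin n → ℝ) (1/2) with hQ
  have hQc : IsCompact Q := isCompact_closedBall _ _
  let v : (Fin n → ℝ) → H := fun t => ∫ x in Q, φ (x + t)
  have hint : ∀ t, IntegrableOn (fun x => φ (x + t)) Q := fun t =>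
    (Continuous.continuousOn (by fun_prop)).integrableOn_compact hQc
  have hv : ∀ s t, inner ℝ (v s) (v t) = ∫ y in Q, ∫ x in Q, f (x + (s - t - y)) := by
    intro s t
    rw [← integral_inner (hint t)]
    congr 1
    ext y
    rw [real_inner_comm, ← integral_inner (hint s)]
    congr 1
    ext x
    rw [real_inner_comm, hφ]
    congr 1
    abel
  have hnorm : ∀ t, ‖v t‖ = ‖v 0‖ := by
    intro t
    rw [← sq_eq_sq₀ (norm_nonneg _) (norm_nonneg _), ← real_inner_self_eq_norm_sq,
      ← real_inner_self_eq_norm_sq, hv, hv]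
    simp
  have hA : inner ℝ (v t) (v 0) ≤ inner ℝ (v 0) (v 0) := by
    rw [real_inner_self_eq_norm_sq, sq]
    refine (real_inner_le_norm _ _).trans_eq ?_
    rw [hnorm t]
  rw [hv, hv] at hA
  simp_rw [hQ, setInt_shift] at hA
  rw [← hQ] at hA
  have hcont : ∀ w : Fin n → ℝ, Continuous fun y => ∫ x in Metric.closedBall (w - y) (1/2), f x := by
    intro w
    have : (fun y => ∫ x in Metric.closedBall (w - y) (1/2), f x) =
        fun y => ∫ x in Q, f (x + (w - y)) := funext fun y => (setInt_shift f (w - y) (1/2)).symm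
    rw [this]
    refine continuous_parametric_integral_of_continuous
      (f := fun y x => f (x + (w - y))) ?_ hQc
    simp only [Function.uncurry_def]
    fun_prop
  have hnn : ∀ w ρ, 0 ≤ ∫ x in Metric.closedBall w ρ, f x := fun w ρ =>
    integral_nonneg h0
  have hup : ∫ y in Q, ∫ x in Metric.closedBall (0 - 0 - y) (1/2), f x ≤
      volume.real Q * ∫ x in Metric.closedBall 0 1, f x := by
    rw [← smul_eq_mul, ← setIntegral_const]
    refine setIntegral_mono_on ((hcont _).continuousOn.integrableOn_compact hQc)
      (integrableOn_const hQc.measure_ne_top) hQc.measurableSet fun y hy => ?_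
    refine setIntegral_mono_set (intOn_closedBall hc _ _) (Filter.Eventually.of_forall h0) ?_
    refine LE.le.eventuallyLE (Metric.closedBall_subset_closedBall' ?_)
    simp only [hQ, mem_closedBall_zero_iff] at hy
    simp
    linarith
  have hlow : volume.real (Metric.closedBall (0 : Fin n → ℝ) (1/4)) *
        ∫ x in Metric.closedBall t (1/4), f x ≤
      ∫ y in Q, ∫ x in Metric.closedBall (t - 0 - y) (1/2), f x := by
    have h1 : ∫ y in Metric.closedBall (0 : Fin n → ℝ) (1/4),
          ∫ x in Metric.closedBall (t - 0 - y) (1/2), f x ≤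
        ∫ y in Q, ∫ x in Metric.closedBall (t - 0 - y) (1/2), f x := by
      refine setIntegral_mono_set ((hcont _).continuousOn.integrableOn_compact hQc)
        (Filter.Eventually.of_forall fun y => hnn _ _) ?_
      exact LE.le.eventuallyLE (Metric.closedBall_subset_closedBall (by norm_num))
    refine le_trans ?_ h1
    rw [← smul_eq_mul, ← setIntegral_const]
    refine setIntegral_mono_on (integrableOn_const (isCompact_closedBall _ _).measure_ne_top)
      ((hcont _).continuousOn.integrableOn_compact (isCompact_closedBall _ _))
      (isCompact_closedBall _ _).measurableSet fun y hy => ?_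
    refine setIntegral_mono_set (intOn_closedBall hc _ _) (Filter.Eventually.of_forall h0) ?_
    refine LE.le.eventuallyLE (Metric.closedBall_subset_closedBall' ?_)
    simp only [mem_closedBall_zero_iff] at hy
    rw [dist_eq_norm]
    simp
    linarith
  linarith

lemma cover_bound {n : ℕ} {f : (Fin n → ℝ) → ℝ} (hc : Continuous f) (h0 : ∀ x, 0 ≤ f x)
    (s : Finset (Fin n → ℝ)) :
    ∫ x in ⋃ t ∈ s, Metric.closedBall t (1/4), f x ≤
      ∑ t ∈ s, ∫ x in Metric.closedBall t (1/4), f x := by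
  classical
  induction s using Finset.induction_on with
  | empty => simp
  | insert a s ha ih =>
    rw [Finset.set_biUnion_insert, Finset.sum_insert ha]
    have hcomp : IsCompact (⋃ t ∈ s, Metric.closedBall t (1/4 : ℝ)) :=
      s.isCompact_biUnion fun t _ => isCompact_closedBall t _
    have h1 := intOn_closedBall hc a (1/4)
    have h2 : IntegrableOn f (⋃ t ∈ s, Metric.closedBall t (1/4)) :=
      hc.continuousOn.integrableOn_compact hcomp
    have := integral_mono_measure (μ := volume.restrict _)
      (Measure.restrict_union_le (μ := volume) (Metric.closedBall a (1/4))
        (⋃ t ∈ s, Metric.closedBall t (1/4))) (Filter.Eventually.of_forall h0)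
        (Integrable.add_measure h1 h2)
    rw [integral_add_measure h1 h2] at this
    linarith

lemma ratioSet_bdd (n : ℕ) (V : Set (Fin n → ℝ)) (hV : IsCompact V) :
    BddAbove (ratioSet n (Set.Icc (fun _ => (-1 : ℝ)) (fun _ => 1)) V) := by
  have hU : (Set.Icc (fun _ => (-1 : ℝ)) (fun _ => 1) : Set (Fin n → ℝ)) =
      Metric.closedBall 0 1 := by
    have := Real.Icc_eq_closedBall
    ext x
    simp only [Set.mem_Icc, Pi.le_def, mem_closedBall_zero_iff, pi_norm_le_iff_of_nonneg zero_le_one,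
      Real.norm_eq_abs, abs_le, forall_and]
  rw [hU]
  obtain ⟨s, -, hsf, hs⟩ := hV.finite_cover_balls (e := 1/4) (by norm_num)
  lift s to Finset (Fin n → ℝ) using hsf
  set c := volume.real (Metric.closedBall (0 : Fin n → ℝ) (1/4)) with hcdef
  set d := volume.real (Metric.closedBall (0 : Fin n → ℝ) (1/2)) with hd
  have hcpos : 0 < c :=
    ENNReal.toReal_pos (Metric.measure_closedBall_pos _ _ (by norm_num)).ne'
      (isCompact_closedBall _ _).measure_ne_top
  set u := (volume (Metric.closedBall (0 : Fin n → ℝ) 1)).toReal with hu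
  have hupos : 0 < u :=
    ENNReal.toReal_pos (Metric.measure_closedBall_pos _ _ (by norm_num)).ne'
      (isCompact_closedBall _ _).measure_ne_top
  refine ⟨(volume V).toReal⁻¹ * (s.card * (d / c)) * u, ?_⟩
  rintro _ ⟨f, hfc, h0, hf, -, hpos, rfl⟩
  rw [div_le_iff₀ (by positivity)]
  have h1 : ∫ x in V, f x ≤ s.card * (d / c) * ∫ x in Metric.closedBall 0 1, f x := by
    calc ∫ x in V, f x ≤ ∫ x in ⋃ t ∈ s, Metric.closedBall t (1/4), f x := by
          refine setIntegral_mono_set (hfc.continuousOn.integrableOn_compact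
            (s.isCompact_biUnion fun t _ => isCompact_closedBall t _))
            (Filter.Eventually.of_forall h0) (LE.le.eventuallyLE ?_)
          refine hs.trans (Set.iUnion₂_mono fun t _ => Metric.ball_subset_closedBall)
      _ ≤ ∑ t ∈ s, ∫ x in Metric.closedBall t (1/4), f x := cover_bound hfc h0 s
      _ ≤ ∑ t ∈ s, (d / c) * ∫ x in Metric.closedBall 0 1, f x := by
          refine Finset.sum_le_sum fun t _ => ?_
          have := key_bound hfc h0 hf t
          rw [div_mul_eq_mul_div, le_div_iff₀ hcpos]
          linarith
      _ = _ := by rw [Finset.sum_const, nsmul_eq_mul]; ring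
  calc _ ≤ (volume V).toReal⁻¹ * (s.card * (d / c) * ∫ x in Metric.closedBall 0 1, f x) := by
        gcongr
    _ = _ := by rw [← hu]; field_simp

/-- A tent bump on the circle. -/
def tent (T ε : ℝ) (y : AddCircle T) : ℝ := max 0 (ε / 2 - ‖y‖)

/-- Autocorrelation of the tent. -/
def tentCorr (T ε : ℝ) [Fact (0 < T)] (x : AddCircle T) : ℝ := ∫ y, tent T ε (y + x) * tent T ε y

lemma tent_continuous (T ε : ℝ) : Continuous (tent T ε) := by
  unfold tent; fun_prop

lemma tent_nonneg (T ε : ℝ) (y : AddCircle T) : 0 ≤ tent T ε y := le_max_left _ _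

lemma tentCorr_nonneg (T ε : ℝ) [Fact (0 < T)] (x : AddCircle T) : 0 ≤ tentCorr T ε x :=
  integral_nonneg fun y => mul_nonneg (tent_nonneg _ _ _) (tent_nonneg _ _ _)

lemma tentCorr_continuous (T ε : ℝ) [Fact (0 < T)] : Continuous (tentCorr T ε) := by
  have := continuous_parametric_integral_of_continuous (μ := (volume : Measure (AddCircle T)))
    (f := fun x y : AddCircle T => tent T ε (y + x) * tent T ε y)
    (by
      have := tent_continuous T ε
      simp only [Function.uncurry_def]
      fun_prop) (isCompact_univ)
  simp only [Measure.restrict_univ] at this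
  exact this

lemma tentCorr_zero_pos (T ε : ℝ) [Fact (0 < T)] (hε : 0 < ε) : 0 < tentCorr T ε 0 := by
  have hc := tent_continuous T ε
  refine Continuous.integral_pos_of_hasCompactSupport_nonneg_nonzero (x := 0) (by fun_prop)
    (HasCompactSupport.of_compactSpace _)
    (fun y => mul_nonneg (tent_nonneg _ _ _) (tent_nonneg _ _ _)) ?_
  have : 0 < tent T ε 0 := by simp [tent, hε]
  simp [this.ne']

lemma tentCorr_integral_pos (T ε : ℝ) [Fact (0 < T)] (hε : 0 < ε) : 0 < ∫ x, tentCorr T ε x :=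
  Continuous.integral_pos_of_hasCompactSupport_nonneg_nonzero (x := 0) (tentCorr_continuous T ε)
    (HasCompactSupport.of_compactSpace _) (fun y => tentCorr_nonneg _ _ _)
    (tentCorr_zero_pos T ε hε).ne'

lemma tentCorr_eq_zero (T ε : ℝ) [Fact (0 < T)] (x : AddCircle T) (hx : ε ≤ ‖x‖) :
    tentCorr T ε x = 0 := by
  unfold tentCorr
  refine integral_eq_zero_of_ae (Filter.Eventually.of_forall fun y => ?_)
  simp only [Pi.zero_apply, tent]
  by_cases h1 : ε / 2 ≤ ‖y‖
  · rw [max_eq_left (a := 0) (b := ε / 2 - ‖y‖) (by linarith), mul_zero]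
  · have : ‖x‖ ≤ ‖y + x‖ + ‖y‖ := by
      have := norm_sub_le (y + x) y
      simpa using this
    rw [max_eq_left (a := 0) (b := ε / 2 - ‖y + x‖) (by linarith), zero_mul]

/-- The test function. -/
def testFun (n : ℕ) (T ε : ℝ) [Fact (0 < T)] (x : Fin n → ℝ) : ℝ :=
  ∏ i, tentCorr T ε (x i : AddCircle T)

lemma tentCorr_coe_continuous (T ε : ℝ) [Fact (0 < T)] :
    Continuous fun x : ℝ => tentCorr T ε (x : AddCircle T) :=
  (tentCorr_continuous T ε).comp (AddCircle.continuous_mk' T)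

lemma testFun_continuous (n : ℕ) (T ε : ℝ) [Fact (0 < T)] : Continuous (testFun n T ε) := by
  have := tentCorr_coe_continuous T ε
  unfold testFun
  exact continuous_finsetProd _ fun i _ => this.comp (continuous_apply i)

lemma testFun_corr (n : ℕ) (T ε : ℝ) [Fact (0 < T)] (a b : Fin n → ℝ) :
    testFun n T ε (a - b) = ∫ y : Fin n → AddCircle T,
      (∏ i, tent T ε (y i + (a i : AddCircle T))) * ∏ i, tent T ε (y i + (b i : AddCircle T)) := by
  simp_rw [← Finset.prod_mul_distrib]
  rw [integral_fintype_prod_volume_eq_prod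
    (f := fun i (y : AddCircle T) => tent T ε (y + (a i : AddCircle T)) *
      tent T ε (y + (b i : AddCircle T)))]
  unfold testFun tentCorr
  refine Finset.prod_congr rfl fun i _ => ?_
  rw [← integral_add_right_eq_self (μ := (volume : Measure (AddCircle T))) _ (b i : AddCircle T)]
  congr 1
  ext y
  congr 2
  simp

lemma testFun_posDef (n : ℕ) (T ε : ℝ) [Fact (0 < T)] : IsPosDefR (testFun n T ε) := by
  intro X c
  let P : (Fin n → ℝ) → (Fin n → AddCircle T) → ℝ := fun a y =>
    ∏ i, tent T ε (y i + (a i : AddCircle T))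
  have hP : ∀ a, Continuous (P a) := fun a =>
    continuous_finsetProd _ fun i _ => (tent_continuous T ε).comp (by fun_prop)
  have hint : ∀ g : (Fin n → AddCircle T) → ℂ, Continuous g → Integrable g := fun g hg =>
    hg.integrable_of_hasCompactSupport (HasCompactSupport.of_compactSpace _)
  have key : ∑ a ∈ X, ∑ b ∈ X, c a * (starRingEnd ℂ) (c b) * (testFun n T ε (a - b) : ℂ) =
      ((∫ y, Complex.normSq (∑ a ∈ X, c a * (P a y : ℂ)) : ℝ) : ℂ) := by
    rw [← integral_complex_ofReal]
    have h1 : ∀ y, ((Complex.normSq (∑ a ∈ X, c a * (P a y : ℂ)) : ℝ) : ℂ) =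
        ∑ a ∈ X, ∑ b ∈ X, c a * (starRingEnd ℂ) (c b) * ((P a y : ℂ) * (P b y : ℂ)) := by
      intro y
      rw [← Complex.mul_conj, map_sum, Finset.sum_mul_sum]
      refine Finset.sum_congr rfl fun a _ => Finset.sum_congr rfl fun b _ => ?_
      simp
      ring
    simp_rw [h1]
    have hc : ∀ a b, Continuous fun y => c a * (starRingEnd ℂ) (c b) * ((P a y : ℂ) * (P b y : ℂ)) := by
      intro a b
      have := hP a
      have := hP b
      fun_prop
    rw [integral_finsetSum _ fun a _ => hint _ (continuous_finsetSum _ fun b _ => hc a b)]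
    refine Finset.sum_congr rfl fun a _ => ?_
    rw [integral_finsetSum _ fun b _ => hint _ (hc a b)]
    refine Finset.sum_congr rfl fun b _ => ?_
    rw [integral_const_mul, testFun_corr, ← integral_complex_ofReal]
    simp [P]
  rw [key]
  refine ⟨?_, Complex.ofReal_im _⟩
  rw [Complex.ofReal_re]
  exact integral_nonneg fun y => Complex.normSq_nonneg _

lemma testFun_integral (n : ℕ) (T ε : ℝ) [Fact (0 < T)] (ρ : ℝ) (hρ : 0 ≤ ρ) :
    ∫ x in Set.Icc (fun _ => -ρ) (fun _ => ρ), testFun n T ε x =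
      (∫ x in (-ρ)..ρ, tentCorr T ε (x : AddCircle T)) ^ n := by
  rw [← Set.pi_univ_Icc, volume_pi, Measure.restrict_pi_pi]
  unfold testFun
  rw [integral_fintype_prod_eq_pow (fun x : ℝ => tentCorr T ε (x : AddCircle T)),
    intervalIntegral.integral_of_le (by linarith), integral_Icc_eq_integral_Ioc]
  simp

lemma vol_cube (n : ℕ) (ρ : ℝ) (hρ : 0 ≤ ρ) :
    (volume (Set.Icc (fun _ => -ρ) (fun _ => ρ) : Set (Fin n → ℝ))).toReal = (2 * ρ) ^ n := by
  rw [Real.volume_Icc_pi_toReal (fun _ => by linarith)]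
  simp
  ring

lemma int_V (r : ℕ) (hr : 1 ≤ r) (T ε : ℝ) [Fact (0 < T)] (hT : T * (2 * r - 1) = 2 * r) :
    ∫ x in (-(r : ℝ))..r, tentCorr T ε (x : AddCircle T) =
      (2 * r - 1) * ∫ x, tentCorr T ε x := by
  have hper : Function.Periodic (fun x : ℝ => tentCorr T ε (x : AddCircle T)) T := by
    intro x; simp
  have h := hper.intervalIntegral_add_zsmul_eq (2 * r - 1 : ℤ) (-(r : ℝ))
    fun a b => (tentCorr_coe_continuous T ε).intervalIntegrable a b
  rw [AddCircle.intervalIntegral_preimage] at h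
  rw [← AddCircle.intervalIntegral_preimage T (-(r : ℝ))]
  have e : -(r : ℝ) + (2 * r - 1 : ℤ) • T = r := by
    simp only [zsmul_eq_mul]; push_cast; linarith
  rw [e] at h
  rw [h, AddCircle.intervalIntegral_preimage]
  simp

lemma int_U (T : ℝ) [Fact (0 < T)] (h1 : 1 < T) (h2 : T ≤ 2) :
    ∫ x in (-1 : ℝ)..1, tentCorr T (T - 1) (x : AddCircle T) = ∫ x, tentCorr T (T - 1) x := by
  have hi : ∀ a b, IntervalIntegrable (fun x : ℝ => tentCorr T (T - 1) (x : AddCircle T)) volume a b :=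
    fun a b => (tentCorr_coe_continuous T _).intervalIntegrable a b
  have hz : ∀ x : ℝ, T / 2 ≤ |x| → |x| ≤ 1 → tentCorr T (T - 1) (x : AddCircle T) = 0 := by
    intro x hx1 hx2
    apply tentCorr_eq_zero
    rcases abs_cases x with ⟨hx, hx0⟩ | ⟨hx, hx0⟩
    · have e : (x : AddCircle T) = ((x - T : ℝ) : AddCircle T) := by
        rw [AddCircle.coe_sub, AddCircle.coe_period, sub_zero]
      have : |x - T| = T - x := by rw [abs_of_nonpos] <;> linarith
      rw [e, (AddCircle.norm_coe_eq_abs_iff T (by linarith)).2, this]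
      · linarith
      · rw [this, abs_of_pos (by linarith)]; linarith
    · have e : (x : AddCircle T) = ((x + T : ℝ) : AddCircle T) := by simp
      have : |x + T| = T + x := by rw [abs_of_nonneg] <;> linarith
      rw [e, (AddCircle.norm_coe_eq_abs_iff T (by linarith)).2, this]
      · linarith
      · rw [this, abs_of_pos (by linarith)]; linarith
  rw [← intervalIntegral.integral_add_adjacent_intervals (hi (-1) (-(T / 2))) (hi _ 1),
    ← intervalIntegral.integral_add_adjacent_intervals (hi (-(T / 2)) (T / 2)) (hi _ 1)]
  have z1 : ∫ x in (-1 : ℝ)..(-(T / 2)), tentCorr T (T - 1) (x : AddCircle T) = 0 := by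
    rw [← intervalIntegral.integral_zero (a := (-1 : ℝ)) (b := -(T / 2)) (μ := volume)]
    refine intervalIntegral.integral_congr fun x hx => ?_
    rw [Set.uIcc_of_le (by linarith)] at hx
    have : |x| = -x := abs_of_nonpos (by linarith [hx.2])
    exact hz x (by linarith [hx.2]) (by linarith [hx.1])
  have z2 : ∫ x in (T / 2)..1, tentCorr T (T - 1) (x : AddCircle T) = 0 := by
    rw [← intervalIntegral.integral_zero (a := T / 2) (b := 1) (μ := volume)]
    refine intervalIntegral.integral_congr fun x hx => ?_
    rw [Set.uIcc_of_le (by linarith)] at hx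
    have : |x| = x := abs_of_nonneg (by linarith [hx.1])
    exact hz x (by linarith [hx.1]) (by linarith [hx.2])
  rw [z1, z2, ← AddCircle.intervalIntegral_preimage T (-(T / 2))]
  have : -(T / 2) + T = T / 2 := by ring
  rw [this]
  ring

/-- For the cubes `U = [-1,1]ⁿ`, `V = [-r,r]ⁿ` one has
`C_n(U,V) ≥ (2r-1)ⁿ 2ⁿ / (2r)ⁿ = (2 - 1/r)ⁿ`. -/
theorem doublingConst_cube_lower_bound (n : ℕ) (r : ℕ) (hr : 1 ≤ r) :
    ((2 * (r : ℝ) - 1) ^ n * 2 ^ n / (2 * (r : ℝ)) ^ n ≤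
      doublingConst n (Set.Icc (fun _ => (-1 : ℝ)) (fun _ => 1))
        (Set.Icc (fun _ => (-(r : ℝ))) (fun _ => (r : ℝ)))) ∧
    (2 * (r : ℝ) - 1) ^ n * 2 ^ n / (2 * (r : ℝ)) ^ n =
      (2 - 1 / (r : ℝ)) ^ n := by
  have hr' : (1 : ℝ) ≤ r := by exact_mod_cast hr
  have hr0 : (0 : ℝ) < r := by linarith
  refine ⟨?_, ?_⟩
  swap
  · rw [← mul_pow, ← div_pow]
    congr 1
    field_simp
  refine le_csSup (ratioSet_bdd n _ isCompact_Icc) ?_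
  have hd : (0 : ℝ) < 2 * r - 1 := by linarith
  set T : ℝ := 2 * r / (2 * r - 1) with hTdef
  have hT : T * (2 * r - 1) = 2 * r := by rw [hTdef]; field_simp
  have hT1 : 1 < T := by rw [hTdef, lt_div_iff₀ hd]; linarith
  have hT2 : T ≤ 2 := by rw [hTdef, div_le_iff₀ hd]; linarith
  have : Fact (0 < T) := ⟨by linarith⟩
  have hI := tentCorr_integral_pos T (T - 1) (by linarith)
  have hUint := testFun_integral n T (T - 1) 1 zero_le_one
  rw [int_U T hT1 hT2] at hUint
  have hVint := testFun_integral n T (T - 1) r hr0.le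
  rw [int_V r hr T (T - 1) hT] at hVint
  refine ⟨testFun n T (T - 1), testFun_continuous _ _ _, fun x => ?_, testFun_posDef _ _ _, ?_, ?_, ?_⟩
  · exact Finset.prod_nonneg fun i _ => tentCorr_nonneg _ _ _
  · intro h
    have h0 := congrFun h 0
    have : 0 < testFun n T (T - 1) 0 :=
      Finset.prod_pos fun i _ => by
        simpa using tentCorr_zero_pos T (T - 1) (by linarith)
    simp [h0] at this
  · rw [hUint]; positivity
  · rw [hUint, hVint, vol_cube n 1 zero_le_one, vol_cube n r hr0.le]
    have := pow_pos hI n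
    rw [mul_pow (2 * (r : ℝ) - 1), mul_one]
    field_simp
end
end

section
/- If f : ℝⁿ → ℝ is continuous, non-negative, and positive definite, then fᵖ is non-negative positive definite for every p ∈ ℕ; consequently |V|⁻¹ ∫_V f(x)ᵖ dx ≤ C_n(U,V) · |U|⁻¹ ∫_U f(x)ᵖ dx. -/
open MeasureTheory Complex Pointwise

noncomputable section

open Filter Topology in
lemma aux_indexed {n : ℕ} {f : (Fin n → ℝ) → ℝ} (hpd : IsPosDefR f) {ι : Type*} (s : Finset ι)
    (x : ι → (Fin n → ℝ)) (c : ι → ℝ) :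
    0 ≤ ∑ i ∈ s, ∑ j ∈ s, c i * c j * f (x i - x j) := by
  classical
  have key : ∀ F : (Fin n → ℝ) → ℝ,
      ∑ a ∈ s.image x, (∑ i ∈ s with x i = a, c i) * F a = ∑ i ∈ s, c i * F (x i) := by
    intro F
    rw [← Finset.sum_fiberwise_of_maps_to (s := s) (t := s.image x) (g := x)
      (fun i hi => Finset.mem_image_of_mem x hi)]
    refine Finset.sum_congr rfl fun a _ => ?_
    rw [Finset.sum_mul]
    refine Finset.sum_congr rfl fun i hi => ?_
    rw [(Finset.mem_filter.1 hi).2]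
  have h := (hpd (s.image x) (fun a => ((∑ i ∈ s with x i = a, c i : ℝ) : ℂ))).1
  have e : (∑ a ∈ s.image x, ∑ b ∈ s.image x, ((∑ i ∈ s with x i = a, c i : ℝ) : ℂ) *
      (starRingEnd ℂ) ((∑ i ∈ s with x i = b, c i : ℝ) : ℂ) * (f (a - b) : ℂ)) =
      ((∑ a ∈ s.image x, ∑ b ∈ s.image x, (∑ i ∈ s with x i = a, c i) *
        (∑ i ∈ s with x i = b, c i) * f (a - b) : ℝ) : ℂ) := by
    simp only [Complex.conj_ofReal]
    push_cast
    rfl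
  simp only at h
  rw [e, Complex.ofReal_re] at h
  have e2 : (∑ a ∈ s.image x, ∑ b ∈ s.image x, (∑ i ∈ s with x i = a, c i) *
        (∑ i ∈ s with x i = b, c i) * f (a - b)) =
      ∑ i ∈ s, ∑ j ∈ s, c i * c j * f (x i - x j) := by
    simp only [mul_assoc, ← Finset.mul_sum]
    rw [← key (fun a => ∑ j ∈ s, c j * f (a - x j))]
    refine Finset.sum_congr rfl fun a _ => ?_
    rw [key (fun b => f (a - b))]
  rwa [e2] at h

lemma aux_even {n : ℕ} {f : (Fin n → ℝ) → ℝ} (hpd : IsPosDefR f) (x : Fin n → ℝ) :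
    f (-x) = f x := by
  classical
  by_cases hx : x = 0
  · simp [hx]
  have h := (hpd {0, x} (fun a => if a = 0 then 1 else Complex.I)).2
  simp [Finset.sum_pair (Ne.symm hx), hx] at h
  linarith

lemma aux_bdd {n : ℕ} {f : (Fin n → ℝ) → ℝ} (hpd : IsPosDefR f) (x : Fin n → ℝ) :
    f x ≤ f 0 := by
  have h := aux_indexed hpd (Finset.univ : Finset (Fin 2)) ![0, x] ![1, -1]
  simp [Fin.sum_univ_two, aux_even hpd] at h
  linarith

open scoped ComplexOrder in
lemma aux_mul {n : ℕ} {f g : (Fin n → ℝ) → ℝ} (hf : IsPosDefR f) (hg : IsPosDefR g) :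
    IsPosDefR (fun x => f x * g x) := by
  classical
  have conv : ∀ h : (Fin n → ℝ) → ℝ, IsPosDefR h → ∀ X : Finset (Fin n → ℝ),
      (Matrix.of fun i j : X => ((h (j.1 - i.1) : ℝ) : ℂ)).PosSemidef := by
    intro h hh X
    refine Matrix.PosSemidef.of_dotProduct_mulVec_nonneg ?_ ?_
    · ext i j
      simp only [Matrix.conjTranspose_apply, Matrix.of_apply]
      rw [← aux_even hh, neg_sub]
      exact Complex.conj_ofReal _
    · intro v
      have := hh X (fun a => if ha : a ∈ X then v ⟨a, ha⟩ else 0)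
      rw [Complex.nonneg_iff]
      have e : star v ⬝ᵥ (Matrix.of (fun i j : X => ((h (j.1 - i.1) : ℝ) : ℂ))).mulVec v =
        ∑ a ∈ X, ∑ b ∈ X, (if ha : a ∈ X then v ⟨a, ha⟩ else 0) *
          (starRingEnd ℂ) (if ha : b ∈ X then v ⟨b, ha⟩ else 0) * ((h (a - b) : ℝ) : ℂ) := by
        rw [Finset.sum_comm]
        simp only [dotProduct, Matrix.mulVec, Finset.mul_sum, Matrix.of_apply]
        rw [← Finset.sum_coe_sort X]
        refine Finset.sum_congr rfl fun i _ => ?_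
        rw [← Finset.sum_coe_sort X]
        refine Finset.sum_congr rfl fun j _ => ?_
        simp
        ring
      rw [e]
      exact ⟨this.1, this.2.symm⟩
  intro X c
  have h := ((conv f hf X).hadamard (conv g hg X)).dotProduct_mulVec_nonneg (fun a => c a)
  rw [Complex.nonneg_iff] at h
  have e : star (fun a : X => c a) ⬝ᵥ
      (Matrix.hadamard (Matrix.of (fun i j : X => ((f (j.1 - i.1) : ℝ) : ℂ)))
        (Matrix.of (fun i j : X => ((g (j.1 - i.1) : ℝ) : ℂ)))).mulVec (fun a : X => c a) =
      ∑ a ∈ X, ∑ b ∈ X, c a * (starRingEnd ℂ) (c b) * ((f (a - b) * g (a - b) : ℝ) : ℂ) := by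
    rw [Finset.sum_comm]
    simp only [dotProduct, Matrix.mulVec, Finset.mul_sum, Matrix.of_apply, Matrix.hadamard_apply]
    rw [← Finset.sum_coe_sort X]
    refine Finset.sum_congr rfl fun i _ => ?_
    rw [← Finset.sum_coe_sort X]
    refine Finset.sum_congr rfl fun j _ => ?_
    simp
    ring
  rw [e] at h
  exact ⟨h.1, h.2.symm⟩

lemma aux_one {n : ℕ} : IsPosDefR (fun _ : Fin n → ℝ => (1 : ℝ)) := by
  intro X c
  have e : (∑ a ∈ X, ∑ b ∈ X, c a * (starRingEnd ℂ) (c b) * ((1 : ℝ) : ℂ)) =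
      ((Complex.normSq (∑ a ∈ X, c a) : ℝ) : ℂ) := by
    rw [Complex.normSq_eq_conj_mul_self, map_sum, mul_comm, Finset.sum_mul_sum]
    simp
  simp only
  rw [e]
  exact ⟨by simpa using Complex.normSq_nonneg _, by simp⟩

lemma aux_pow {n : ℕ} {f : (Fin n → ℝ) → ℝ} (hf : IsPosDefR f) (p : ℕ) :
    IsPosDefR (fun x => f x ^ p) := by
  induction p with
  | zero => simpa using aux_one
  | succ k ih => simpa only [pow_succ] using aux_mul ih hf

lemma aux_simple {n : ℕ} (μ : Measure (Fin n → ℝ)) [IsFiniteMeasure μ]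
    (s : SimpleFunc (Fin n → ℝ) (Fin n → ℝ)) (φ : (Fin n → ℝ) → ℝ) :
    ∫ x, φ (s x) ∂μ = ∑ a ∈ s.range, μ.real (s ⁻¹' {a}) * φ a := by
  classical
  have e : ∀ x, φ (s x) = ∑ a ∈ s.range, (s ⁻¹' {a}).indicator (fun _ => φ a) x := by
    intro x
    rw [Finset.sum_eq_single (s x)]
    · simp
    · intro b _ hb
      simp [Set.indicator, Ne.symm hb]
    · intro h
      exact absurd (SimpleFunc.mem_range_self s x) h
  simp_rw [e]
  rw [integral_finsetSum]
  · refine Finset.sum_congr rfl fun a _ => ?_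
    rw [integral_indicator_const _ (s.measurableSet_fiber a), smul_eq_mul]
  · intro a _
    exact (integrable_const _).indicator (s.measurableSet_fiber a)

open Filter Topology in
lemma aux_integral {n : ℕ} (μ : Measure (Fin n → ℝ)) [IsFiniteMeasure μ]
    (g : (Fin n → ℝ) → ℝ) (hg : Continuous g) (M : ℝ) (hM : ∀ x, ‖g x‖ ≤ M)
    (hpos : ∀ (X : Finset (Fin n → ℝ)) (c : (Fin n → ℝ) → ℝ),
      0 ≤ ∑ a ∈ X, ∑ b ∈ X, c a * c b * g (b - a)) :
    0 ≤ ∫ x, ∫ y, g (y - x) ∂μ ∂μ := by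
  let s : ℕ → SimpleFunc (Fin n → ℝ) (Fin n → ℝ) := fun k =>
    SimpleFunc.approxOn id measurable_id Set.univ 0 (Set.mem_univ _) k
  have hs : ∀ x, Tendsto (fun k => s k x) atTop (𝓝 x) := fun x =>
    SimpleFunc.tendsto_approxOn (f := id) measurable_id (Set.mem_univ _) (by simp)
  have hin : ∀ x, Tendsto (fun k => ∫ y, g (s k y - s k x) ∂μ) atTop
      (𝓝 (∫ y, g (y - x) ∂μ)) := by
    intro x
    refine tendsto_integral_of_dominated_convergence (fun _ => M) ?_ (integrable_const _) ?_ ?_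
    · intro k
      exact ((s k).map (fun a => g (a - s k x))).aestronglyMeasurable
    · intro k
      exact Eventually.of_forall fun y => hM _
    · exact Eventually.of_forall fun y => (hg.tendsto _).comp ((hs y).sub (hs x))
  have hout : Tendsto (fun k => ∫ x, ∫ y, g (s k y - s k x) ∂μ ∂μ) atTop
      (𝓝 (∫ x, ∫ y, g (y - x) ∂μ ∂μ)) := by
    refine tendsto_integral_of_dominated_convergence (fun _ => M * μ.real Set.univ) ?_
      (integrable_const _) ?_ ?_
    · intro k
      exact ((s k).map (fun a => ∫ y, g (s k y - a) ∂μ)).aestronglyMeasurable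
    · intro k
      exact Eventually.of_forall fun x =>
        norm_integral_le_of_norm_le_const (Eventually.of_forall fun y => hM _)
    · exact Eventually.of_forall hin
  refine ge_of_tendsto' hout fun k => ?_
  rw [aux_simple μ (s k) (fun a => ∫ y, g (s k y - a) ∂μ)]
  have := hpos (s k).range (fun a => μ.real (s k ⁻¹' {a}))
  refine this.trans_eq (Finset.sum_congr rfl fun a _ => ?_)
  rw [aux_simple μ (s k) (fun b => g (b - a)), Finset.mul_sum]
  refine Finset.sum_congr rfl fun b _ => ?_
  ring

lemma aux_second {n : ℕ} {f : (Fin n → ℝ) → ℝ} (hpd : IsPosDefR f) (t : Fin n → ℝ)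
    (X : Finset (Fin n → ℝ)) (c : (Fin n → ℝ) → ℝ) :
    0 ≤ ∑ a ∈ X, ∑ b ∈ X, c a * c b *
      (2 * f (b - a) - f (b - a - t) - f (b - a + t)) := by
  have h := aux_indexed hpd (X ×ˢ (Finset.univ : Finset Bool))
    (fun q => if q.2 then q.1 + t else q.1) (fun q => if q.2 then - c q.1 else c q.1)
  simp only [Finset.sum_product, Fintype.sum_bool] at h
  refine h.trans_eq ?_
  refine Finset.sum_congr rfl fun a _ => ?_
  rw [← Finset.sum_add_distrib]
  refine Finset.sum_congr rfl fun b _ => ?_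
  have e1 : a + t - (b + t) = a - b := by abel
  have e2 : a + t - b = a - b + t := by abel
  have e3 : a - (b + t) = a - b - t := by abel
  have e4 : b - a - t = -(a - b + t) := by abel
  have e5 : b - a + t = -(a - b - t) := by abel
  have e6 : b - a = -(a - b) := by abel
  simp only [if_true, Bool.false_eq_true, if_false]
  rw [e1, e2, e3, e4, e5, e6, aux_even hpd, aux_even hpd, aux_even hpd]
  ring

lemma aux_shift {n : ℕ} (f : (Fin n → ℝ) → ℝ) (w : Fin n → ℝ) (ρ : ℝ) :
    ∫ y in Metric.ball 0 ρ, f (y - w) = ∫ z in Metric.ball (-w) ρ, f z := by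
  rw [← integral_indicator Metric.isOpen_ball.measurableSet,
    ← integral_indicator Metric.isOpen_ball.measurableSet,
    ← integral_sub_right_eq_self ((Metric.ball (-w) ρ).indicator f) w]
  congr 1
  ext y
  simp [Set.indicator, Metric.mem_ball, dist_eq_norm]

lemma aux_intOn {n : ℕ} {f : (Fin n → ℝ) → ℝ} (hc : Continuous f) (w : Fin n → ℝ) (ρ : ℝ) :
    IntegrableOn f (Metric.ball w ρ) :=
  (hc.continuousOn.integrableOn_compact (isCompact_closedBall w ρ)).mono_set
    Metric.ball_subset_closedBall

lemma aux_int_prod {n : ℕ} (μ : Measure (Fin n → ℝ)) [IsFiniteMeasure μ]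
    (h : (Fin n → ℝ) → ℝ) (hg : Continuous h) (M : ℝ) (hM : ∀ x, ‖h x‖ ≤ M) :
    Integrable (fun x => ∫ y, h (y - x) ∂μ) μ := by
  have : Integrable (fun q : (Fin n → ℝ) × (Fin n → ℝ) => h (q.2 - q.1)) (μ.prod μ) :=
    Integrable.of_bound (by fun_prop : Continuous _).aestronglyMeasurable M
      (Filter.Eventually.of_forall fun q => hM _)
  exact this.integral_prod_left

lemma aux_local {n : ℕ} {f : (Fin n → ℝ) → ℝ} (hc : Continuous f) (hnn : ∀ x, 0 ≤ f x)
    (hpd : IsPosDefR f) {r : ℝ} (hr : 0 < r) (t : Fin n → ℝ) :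
    volume.real (Metric.ball (0 : Fin n → ℝ) r) * ∫ z in Metric.ball (-t) r, f z ≤
      2 * (volume.real (Metric.ball (0 : Fin n → ℝ) (2 * r)) *
        ∫ z in Metric.ball 0 (4 * r), f z) := by
  set B := Metric.ball (0 : Fin n → ℝ) (2 * r) with hB
  set D := Metric.ball (0 : Fin n → ℝ) r with hD
  have hDB : D ⊆ B := Metric.ball_subset_ball (by linarith)
  have hfin : volume B < ⊤ := Metric.isBounded_ball.measure_lt_top
  have hfinD : volume D < ⊤ := Metric.isBounded_ball.measure_lt_top
  have : IsFiniteMeasure (volume.restrict B) := ⟨by simpa using hfin⟩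
  have hb : ∀ x, ‖f x‖ ≤ f 0 := fun x => by
    rw [Real.norm_of_nonneg (hnn x)]; exact aux_bdd hpd x
  have hct : Continuous fun x => f (x - t) := by fun_prop
  have hmain : 0 ≤ ∫ x in B, ∫ y in B,
      (2 * f (y - x) - f (y - x - t) - f (y - x + t)) := by
    refine aux_integral (volume.restrict B)
      (fun z => 2 * f z - f (z - t) - f (z + t)) (by fun_prop) (4 * f 0) ?_
      (aux_second hpd t)
    intro z
    have h1 := hnn z
    have h2 := hnn (z - t)
    have h3 := hnn (z + t)
    have h4 := aux_bdd hpd z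
    have h5 := aux_bdd hpd (z - t)
    have h6 := aux_bdd hpd (z + t)
    rw [Real.norm_eq_abs, abs_le]
    constructor <;> linarith
  have hi : ∀ (h : (Fin n → ℝ) → ℝ), Continuous h → IntegrableOn h B := fun h hh =>
    aux_intOn hh _ _
  have i1 : IntegrableOn (fun x => ∫ y in B, f (y - x)) B :=
    aux_int_prod (volume.restrict B) f hc (f 0) hb
  have i2 : IntegrableOn (fun x => ∫ y in B, f (y - x - t)) B :=
    aux_int_prod (volume.restrict B) (fun z => f (z - t)) hct (f 0) (fun _ => hb _)
  have i3 : IntegrableOn (fun x => ∫ y in B, f (y - x + t)) B :=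
    aux_int_prod (volume.restrict B) (fun z => f (z + t)) (by fun_prop) (f 0) (fun _ => hb _)
  have e : ∀ x, ∫ y in B, (2 * f (y - x) - f (y - x - t) - f (y - x + t)) =
      2 * (∫ y in B, f (y - x)) - (∫ y in B, f (y - x - t)) - ∫ y in B, f (y - x + t) := by
    intro x
    rw [integral_sub, integral_sub, integral_const_mul]
    all_goals exact hi _ (by fun_prop)
  simp_rw [e] at hmain
  have i12 : IntegrableOn (fun x => 2 * (∫ y in B, f (y - x)) - ∫ y in B, f (y - x - t)) B :=
    (i1.const_mul 2).sub i2
  rw [integral_sub i12 i3, integral_sub (i1.const_mul 2) i2,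
    integral_const_mul] at hmain
  have hp : 0 ≤ ∫ x in B, ∫ y in B, f (y - x + t) :=
    integral_nonneg fun x => integral_nonneg fun y => hnn _
  have up : ∫ x in B, ∫ y in B, f (y - x) ≤
      volume.real B * ∫ z in Metric.ball 0 (4 * r), f z := by
    have : ∫ x in B, ∫ y in B, f (y - x) ≤ ∫ x in B, ∫ z in Metric.ball 0 (4 * r), f z := by
      refine setIntegral_mono_on i1 (integrableOn_const hfin.ne)
        Metric.isOpen_ball.measurableSet ?_
      intro x hx
      rw [aux_shift]
      refine setIntegral_mono_set (aux_intOn hc _ _)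
        (Filter.Eventually.of_forall fun z => hnn z) (LE.le.eventuallyLE ?_)
      refine Metric.ball_subset_ball' ?_
      have : ‖x‖ < 2 * r := by simpa [hB] using hx
      rw [dist_zero_right, norm_neg]
      linarith
    refine this.trans_eq ?_
    rw [setIntegral_const, smul_eq_mul]
  have lo : volume.real D * ∫ z in Metric.ball (-t) r, f z ≤
      ∫ x in B, ∫ y in B, f (y - x - t) := by
    have h1 : ∫ x in D, ∫ z in Metric.ball (-t) r, f z ≤
        ∫ x in D, ∫ y in B, f (y - x - t) := by
      refine setIntegral_mono_on (integrableOn_const hfinD.ne) (i2.mono_set hDB)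
        Metric.isOpen_ball.measurableSet ?_
      intro x hx
      simp_rw [sub_sub]
      rw [aux_shift]
      refine setIntegral_mono_set (aux_intOn hc _ _)
        (Filter.Eventually.of_forall fun z => hnn z) (LE.le.eventuallyLE ?_)
      refine Metric.ball_subset_ball' ?_
      have : ‖x‖ < r := by simpa [hD] using hx
      have e : -t - -(x + t) = x := by abel
      rw [dist_eq_norm, e]
      linarith
    rw [setIntegral_const, smul_eq_mul] at h1
    refine h1.trans (setIntegral_mono_set i2 ?_ (LE.le.eventuallyLE hDB))
    exact Filter.Eventually.of_forall fun x => integral_nonneg fun y => hnn _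
  linarith

lemma aux_zero_mem {n : ℕ} {U : Set (Fin n → ℝ)} (hU : IsSymConvexBody U) :
    ∃ r : ℝ, 0 < r ∧ Metric.ball 0 (4 * r) ⊆ U := by
  obtain ⟨hconv, -, ⟨x, hx⟩, hsym⟩ := hU
  have hx' : -x ∈ U := by
    rw [hsym]
    simpa using interior_subset hx
  have h0 : (0 : Fin n → ℝ) ∈ interior U := by
    have := hconv.combo_interior_self_mem_interior hx hx' (a := 1 / 2) (b := 1 / 2)
      (by norm_num) (by norm_num) (by norm_num)
    simpa using this
  obtain ⟨ε, hε, h⟩ := Metric.isOpen_iff.1 isOpen_interior 0 h0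
  refine ⟨ε / 4, by positivity, ?_⟩
  rw [mul_div_cancel₀ _ (by norm_num : (4 : ℝ) ≠ 0)]
  exact h.trans interior_subset

lemma aux_doubling {n : ℕ} {U V : Set (Fin n → ℝ)}
    (hU : IsSymConvexBody U) (hV : IsSymConvexBody V) :
    ∃ K : ℝ, 0 ≤ K ∧ ∀ f : (Fin n → ℝ) → ℝ, Continuous f → (∀ x, 0 ≤ f x) → IsPosDefR f →
      ∫ x in V, f x ≤ K * ∫ x in U, f x := by
  obtain ⟨r, hr, hrU⟩ := aux_zero_mem hU
  obtain ⟨T, -, hTfin, hT⟩ := hV.2.1.finite_cover_balls hr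
  lift T to Finset (Fin n → ℝ) using hTfin
  set d := volume.real (Metric.ball (0 : Fin n → ℝ) r) with hd
  set b := volume.real (Metric.ball (0 : Fin n → ℝ) (2 * r)) with hb
  have hdpos : 0 < d := ENNReal.toReal_pos (Metric.measure_ball_pos _ _ hr).ne'
    Metric.isBounded_ball.measure_lt_top.ne
  have hb0 : 0 ≤ b := measureReal_nonneg
  refine ⟨T.card * (2 * b / d), by positivity, fun f hc hnn hpd => ?_⟩
  have h4 : ∫ z in Metric.ball 0 (4 * r), f z ≤ ∫ x in U, f x :=
    setIntegral_mono_set (hc.continuousOn.integrableOn_compact hU.2.1)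
      (Filter.Eventually.of_forall fun z => hnn z) (LE.le.eventuallyLE hrU)
  have hloc : ∀ t, ∫ z in Metric.ball t r, f z ≤ 2 * b / d * ∫ x in U, f x := by
    intro t
    have h := aux_local hc hnn hpd hr (-t)
    rw [neg_neg] at h
    have h5 := mul_le_mul_of_nonneg_left h4 hb0
    rw [div_mul_eq_mul_div, le_div_iff₀ hdpos]
    linarith
  have h1 : ∫ x in V, f x ≤ ∑ t ∈ T, ∫ x in Metric.ball t r, f x := by
    have hsub : ∀ x, V.indicator f x ≤ ∑ t ∈ T, (Metric.ball t r).indicator f x := by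
      intro x
      have nn : ∀ t ∈ T, 0 ≤ (Metric.ball t r).indicator f x := fun t _ =>
        Set.indicator_nonneg (fun z _ => hnn z) x
      by_cases hx : x ∈ V
      · obtain ⟨t, ht, hxt⟩ := Set.mem_iUnion₂.1 (hT hx)
        rw [Set.indicator_of_mem hx]
        refine le_trans ?_ (Finset.single_le_sum nn ht)
        rw [Set.indicator_of_mem hxt]
      · rw [Set.indicator_of_notMem hx]
        exact Finset.sum_nonneg nn
    have hint : ∀ t ∈ T, Integrable ((Metric.ball t r).indicator f) := fun t _ =>
      (integrable_indicator_iff Metric.isOpen_ball.measurableSet).2 (aux_intOn hc t r)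
    have hm := hV.2.1.isClosed.measurableSet
    rw [← integral_indicator hm]
    have e : ∑ t ∈ T, ∫ x in Metric.ball t r, f x =
        ∫ x, ∑ t ∈ T, (Metric.ball t r).indicator f x := by
      rw [integral_finsetSum _ hint]
      exact Finset.sum_congr rfl fun t _ =>
        (integral_indicator Metric.isOpen_ball.measurableSet).symm
    rw [e]
    exact integral_mono ((integrable_indicator_iff hm).2
      (hc.continuousOn.integrableOn_compact hV.2.1)) (integrable_finsetSum _ hint) hsub
  refine h1.trans ((Finset.sum_le_sum fun t _ => hloc t).trans_eq ?_)
  rw [Finset.sum_const, nsmul_eq_mul, mul_assoc]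

lemma aux_vol_pos {n : ℕ} {U : Set (Fin n → ℝ)} (hU : IsSymConvexBody U) :
    0 < (volume U).toReal :=
  ENNReal.toReal_pos (Measure.measure_pos_of_nonempty_interior _ hU.2.2.1).ne' hU.2.1.measure_lt_top.ne

lemma aux_final {n : ℕ} {U V : Set (Fin n → ℝ)}
    (hU : IsSymConvexBody U) (hV : IsSymConvexBody V)
    (f : (Fin n → ℝ) → ℝ) (hc : Continuous f) (hnn : ∀ x, 0 ≤ f x) (hpd : IsPosDefR f) :
    (volume V).toReal⁻¹ * ∫ x in V, f x ≤
      doublingConst n U V * ((volume U).toReal⁻¹ * ∫ x in U, f x) := by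
  obtain ⟨K, hK, hdoub⟩ := aux_doubling hU hV
  have hu := aux_vol_pos hU
  have hv := aux_vol_pos hV
  have hI : 0 ≤ ∫ x in U, f x := integral_nonneg fun x => hnn x
  have hJ : 0 ≤ ∫ x in V, f x := integral_nonneg fun x => hnn x
  rcases hI.eq_or_lt with h0 | hpos
  · have h := hdoub f hc hnn hpd
    rw [← h0, mul_zero] at h
    rw [← h0, le_antisymm h hJ]
    simp
  · have hbdd : BddAbove (ratioSet n U V) := by
      refine ⟨(volume V).toReal⁻¹ * K * (volume U).toReal, ?_⟩
      rintro c ⟨g, gc, gnn, gpd, -, gpos, rfl⟩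
      rw [div_le_iff₀ (by positivity)]
      have h := mul_le_mul_of_nonneg_left (hdoub g gc gnn gpd) (inv_nonneg.2 hv.le)
      refine h.trans_eq ?_
      field_simp
    have hmem : ((volume V).toReal⁻¹ * ∫ x in V, f x) / ((volume U).toReal⁻¹ * ∫ x in U, f x)
        ∈ ratioSet n U V := by
      refine ⟨f, hc, hnn, hpd, ?_, hpos, rfl⟩
      rintro rfl
      simp at hpos
    have h := le_csSup hbdd hmem
    rwa [div_le_iff₀ (by positivity)] at h

/-- Powers of non-negative positive definite functions are non-negative positive
definite, and hence satisfy the doubling inequality with constant `C_n(U,V)`. -/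
theorem posdef_pow {n : ℕ} (U V : Set (Fin n → ℝ))
    (hU : IsSymConvexBody U) (hV : IsSymConvexBody V)
    (f : (Fin n → ℝ) → ℝ) (hc : Continuous f) (hnn : ∀ x, 0 ≤ f x)
    (hpd : IsPosDefR f) (p : ℕ) :
    IsPosDefR (fun x => f x ^ p) ∧
    (volume V).toReal⁻¹ * ∫ x in V, f x ^ p ≤
      doublingConst n U V * ((volume U).toReal⁻¹ * ∫ x in U, f x ^ p) := by
  exact ⟨aux_pow hpd p,
    aux_final hU hV _ (hc.pow p) (fun x => pow_nonneg (hnn x) p) (aux_pow hpd p)⟩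
end
end
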